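/- arXiv:2511.21370 — 7 statements merged into one kernel-verified Lean document; each statement's English description precedes it below -/
import Mathlib

section
/- Let k be a positive integer and let r_1, …, r_k be nonnegative real numbers with sum R := r_1 + ⋯ + r_k, and assume R > 0. Then equality V(r_1,…,r_k) = R / (1 + R), where V(r_1,…,r_k) := R / ∏_{j=1}^k (1 + r_j), holds if and only if there is an index i with r_i = R and r_j = 0 for all j ≠ i. -/
theorem one_add_sum_le_prod_aux {ι : Type*} [DecidableEq ι] (s : Finset ι) (r : ι → ℝ)
    (hr : ∀ j, 0 ≤ r j) : 1 + ∑ j ∈ s, r j ≤ ∏ j ∈ s, (1 + r j) := by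
  induction s using Finset.induction_on with
  | empty => simp
  | insert a s ha ih =>
    rw [Finset.sum_insert ha, Finset.prod_insert ha]
    have h1 : 0 ≤ ∑ j ∈ s, r j := Finset.sum_nonneg fun j _ => hr j
    nlinarith [mul_nonneg (hr a) h1, mul_le_mul_of_nonneg_left ih (by linarith [hr a] : 0 ≤ 1 + r a)]

/-- Equality characterization in Theorem 2 of the paper: for nonnegative odds with
positive sum `R`, the upper bound `V = R / (1 + R)` is attained if and only if all
the mass is concentrated at a single index. -/
theorem odds_upper_bound_equality_iff (k : ℕ) (hk : 0 < k) (r : Fin k → ℝ)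
    (hr : ∀ j, 0 ≤ r j) (hR : 0 < ∑ j, r j) :
    (∑ j, r j) / ∏ j, (1 + r j) = (∑ j, r j) / (1 + ∑ j, r j) ↔
      ∃ i, r i = ∑ j, r j ∧ ∀ j, j ≠ i → r j = 0 := by
  constructor
  · intro h
    have hP : 0 < ∏ j, (1 + r j) := Finset.prod_pos fun j _ => by linarith [hr j]
    rw [div_eq_div_iff hP.ne' (by linarith)] at h
    have h2 := mul_left_cancel₀ hR.ne' h
    obtain ⟨i, -, hi⟩ := Finset.exists_lt_of_sum_lt
      (s := Finset.univ) (f := fun _ : Fin k => (0 : ℝ)) (g := r) (by simpa using hR)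
    have hs := Finset.add_sum_erase Finset.univ r (Finset.mem_univ i)
    have hp := Finset.mul_prod_erase Finset.univ (fun j => 1 + r j) (Finset.mem_univ i)
    have hle := one_add_sum_le_prod_aux (Finset.univ.erase i) r hr
    have h0 : 0 ≤ ∑ j ∈ Finset.univ.erase i, r j := Finset.sum_nonneg fun j _ => hr j
    have h3 := mul_le_mul_of_nonneg_left hle (by linarith [hr i] : 0 ≤ 1 + r i)
    have h4 : r i * ∑ j ∈ Finset.univ.erase i, r j ≤ 0 := by
      rw [hp, ← h2, ← hs] at h3
      linarith
    have h5 : ∑ j ∈ Finset.univ.erase i, r j = 0 :=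
      le_antisymm (nonpos_of_mul_nonpos_right h4 hi) h0
    refine ⟨i, by linarith, fun j hj => ?_⟩
    exact (Finset.sum_eq_zero_iff_of_nonneg fun j _ => hr j).1 h5 j (by simp [hj])
  · rintro ⟨i, hi, h⟩
    have hp : ∏ j, (1 + r j) = 1 + r i :=
      Finset.prod_eq_single i (fun j _ hj => by simp [h j hj]) (by simp)
    rw [hp, hi]
end

section
/- Let n be a positive integer and let r_1, …, r_n be nonnegative real numbers with sum R := r_1 + ⋯ + r_n satisfying 0 ≤ R < 1. Then V(r_1,…,r_n) := R / ∏_{j=1}^n (1 + r_j) satisfies V(r_1,…,r_n) ≥ R · (1 + R/n)^{−n}. -/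
/-- Item 1 of Theorem 3 of the paper: if the nonnegative odds `r₁, …, r_n` have sum
`R < 1`, then `V = R / ∏ (1 + r_j) ≥ R · (1 + R/n)⁻ⁿ`. -/
theorem odds_lower_bound_case1 (n : ℕ) (hn : 0 < n) (r : Fin n → ℝ)
    (hr : ∀ j, 0 ≤ r j) (hR : ∑ j, r j < 1) :
    (∑ j, r j) * ((1 + (∑ j, r j) / n) ^ n)⁻¹ ≤ (∑ j, r j) / ∏ j, (1 + r j) := by
  have hn' : (0 : ℝ) < n := by exact_mod_cast hn
  have h0 : 0 ≤ ∑ j, r j := Finset.sum_nonneg fun j _ => hr j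
  have hz : ∀ j, 0 < 1 + r j := fun j => by linarith [hr j]
  have hP : 0 < ∏ j, (1 + r j) := Finset.prod_pos fun j _ => hz j
  have key := Real.geom_mean_le_arith_mean Finset.univ (fun _ : Fin n => (1 : ℝ))
    (fun j => 1 + r j) (fun _ _ => zero_le_one) (by simpa using hn) (fun j _ => (hz j).le)
  simp only [Real.rpow_one, one_mul, Finset.sum_add_distrib, Finset.sum_const,
    Finset.card_univ, Fintype.card_fin, nsmul_eq_mul, mul_one] at key
  rw [add_div, div_self hn'.ne'] at key
  have h2 := pow_le_pow_left₀ (Real.rpow_nonneg hP.le _) key n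
  rw [Real.rpow_inv_natCast_pow hP.le hn.ne'] at h2
  rw [div_eq_mul_inv]
  exact mul_le_mul_of_nonneg_left (inv_anti₀ hP h2) h0
end

section
/- Let k ≥ 2 be an integer and let r_1, …, r_k be nonnegative real numbers with sum R := r_1 + ⋯ + r_k satisfying 1 ≤ R ≤ 1 + 1/(k−1). Then V(r_1,…,r_k) := R / ∏_{j=1}^k (1 + r_j) satisfies V(r_1,…,r_k) ≥ (1 + 1/k)^{−k}. -/
/-- Item 2 of Theorem 3 of the paper: if the nonnegative odds `r₁, …, r_k` (with
`k ≥ 2`) have sum `R` with `1 ≤ R ≤ 1 + 1/(k-1)`, then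
`V = R / ∏ (1 + r_j) ≥ (1 + 1/k)⁻ᵏ`. -/
theorem odds_lower_bound_case2 (k : ℕ) (hk : 2 ≤ k) (r : Fin k → ℝ)
    (hr : ∀ j, 0 ≤ r j) (hR1 : 1 ≤ ∑ j, r j)
    (hR2 : ∑ j, r j ≤ 1 + 1 / ((k : ℝ) - 1)) :
    ((1 + 1 / (k : ℝ)) ^ k)⁻¹ ≤ (∑ j, r j) / ∏ j, (1 + r j) := by
  have hk' : (2 : ℝ) ≤ k := by exact_mod_cast hk
  obtain ⟨R, hR⟩ : ∃ R, R = ∑ j, r j := ⟨_, rfl⟩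
  have hk0 : (0 : ℝ) < k := by linarith
  have hm : 0 < 1 + R / k := by rw [hR]; positivity
  have amgm : ∏ j, (1 + r j) ≤ (1 + R / k) ^ k := by
    calc ∏ j, (1 + r j)
        ≤ ∏ j, ((1 + R / k) * Real.exp ((1 + r j) / (1 + R / k) - 1)) := by
          apply Finset.prod_le_prod
          · intro j _
            linarith [hr j]
          · intro j _
            have h := Real.add_one_le_exp ((1 + r j) / (1 + R / k) - 1)
            rw [sub_add_cancel, div_le_iff₀ hm] at h
            linarith
      _ = (1 + R / k) ^ k := by
          rw [Finset.prod_mul_distrib, ← Real.exp_sum, Finset.sum_sub_distrib,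
            ← Finset.sum_div, Finset.sum_add_distrib, ← hR]
          have : ((k : ℝ) + R) / (1 + R / k) - k = 0 := by
            have h2 : (k : ℝ) + R = k * (1 + R / k) := by field_simp
            rw [h2, mul_div_assoc, div_self hm.ne']
            ring
          simp [this]
  rw [← hR] at hR1 hR2 ⊢
  have hRk : (k - 1) * R ≤ (k : ℝ) := by
    have h1 : (0 : ℝ) < k - 1 := by linarith
    have : (1 : ℝ) + 1 / (k - 1) = k / (k - 1) := by field_simp; ring
    rw [this, le_div_iff₀ h1] at hR2
    linarith
  have hkR : 0 < (k : ℝ) + R := by linarith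
  have hbern := one_add_mul_le_pow (a := -((R - 1) / (k + R))) (by
    have : (R - 1) / (k + R) ≤ 1 := by
      rw [div_le_one hkR]; linarith
    linarith) k
  have h3 : 1 / R ≤ 1 + (k : ℝ) * -((R - 1) / (k + R)) := by
    have : 1 + (k : ℝ) * -((R - 1) / (k + R)) = (2 * k + R - k * R) / (k + R) := by
      field_simp; ring
    rw [this, div_le_div_iff₀ (by linarith) hkR]
    nlinarith [mul_nonneg (sub_nonneg.2 hR1) (sub_nonneg.2 hRk)]
  have h4 : 1 + -((R - 1) / (k + R)) = (1 + 1 / (k : ℝ)) / (1 + R / k) := by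
    field_simp; ring
  rw [h4, div_pow] at hbern
  have h5 := h3.trans hbern
  rw [div_le_div_iff₀ (by linarith) (by positivity)] at h5
  rw [inv_eq_one_div, div_le_div_iff₀ (by positivity)
    (Finset.prod_pos fun j _ => by linarith [hr j])]
  linarith
end

section
/- Let m be a positive integer and let r_0, r_1, …, r_m be nonnegative real numbers. Set R := r_0 + r_1 + ⋯ + r_m and R' := r_1 + ⋯ + r_m, and assume R > 1 + 1/m and R' < 1. Then V(r_0,…,r_m) := R / ∏_{j=0}^m (1 + r_j) satisfies the strict inequality V(r_0,…,r_m) > (1 + 1/m)^{−m}. -/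
theorem amgm_aux (n : ℕ) (hn : 0 < n) (z : ℕ → ℝ) (hz : ∀ j ∈ Finset.range n, 0 ≤ z j) :
    ∏ j ∈ Finset.range n, z j ≤ ((∑ j ∈ Finset.range n, z j) / n) ^ n := by
  have hn' : (n : ℝ) ≠ 0 := by positivity
  have h := Real.geom_mean_le_arith_mean_weighted (Finset.range n) (fun _ => (1 : ℝ) / n) z
    (fun _ _ => by positivity) (by simp [hn']) hz
  have h0 : 0 ≤ ∏ j ∈ Finset.range n, z j ^ ((1 : ℝ) / n) :=
    Finset.prod_nonneg fun j hj => Real.rpow_nonneg (hz j hj) _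
  have h2 := pow_le_pow_left₀ h0 h n
  rw [← Finset.prod_pow, ← Finset.mul_sum] at h2
  have h3 : ∏ j ∈ Finset.range n, (z j ^ ((1 : ℝ) / n)) ^ n = ∏ j ∈ Finset.range n, z j := by
    refine Finset.prod_congr rfl fun j hj => ?_
    rw [← Real.rpow_natCast, ← Real.rpow_mul (hz j hj), one_div_mul_cancel hn', Real.rpow_one]
  rw [h3] at h2
  rwa [one_div, inv_mul_eq_div] at h2


/-- Item 3 of Theorem 3 of the paper: for nonnegative odds `r₀, r₁, …, r_m` with
`R = r₀ + ⋯ + r_m > 1 + 1/m` and `R' = r₁ + ⋯ + r_m < 1`, the success probability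
`V = R / ∏ (1 + r_j)` satisfies the strict inequality `V > (1 + 1/m)⁻ᵐ`. -/
theorem odds_lower_bound_case3 (m : ℕ) (hm : 0 < m) (r : ℕ → ℝ)
    (hr : ∀ j ≤ m, 0 ≤ r j)
    (hR : 1 + 1 / (m : ℝ) < ∑ j ∈ Finset.range (m + 1), r j)
    (hR' : ∑ j ∈ Finset.Icc 1 m, r j < 1) :
    ((1 + 1 / (m : ℝ)) ^ m)⁻¹ <
      (∑ j ∈ Finset.range (m + 1), r j) / ∏ j ∈ Finset.range (m + 1), (1 + r j) := by
  have hS : ∑ j ∈ Finset.Icc 1 m, r j = ∑ j ∈ Finset.range m, r (j + 1) := by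
    rw [Finset.range_eq_Ico, Finset.sum_Ico_add' r 0 m 1]
    rfl
  rw [hS] at hR'
  rw [Finset.sum_range_succ'] at hR ⊢
  rw [Finset.prod_range_succ']
  have hz : ∀ j ∈ Finset.range m, 0 ≤ r (j + 1) := fun j hj =>
    hr _ (by have := Finset.mem_range.mp hj; omega)
  have hP : 0 < ∏ j ∈ Finset.range m, (1 + r (j + 1)) :=
    Finset.prod_pos fun j hj => by have := hz j hj; linarith
  have hm' : (0 : ℝ) < m := by exact_mod_cast hm
  have ht : 0 < 1 / (m : ℝ) := by positivity
  have h0 := hr 0 (Nat.zero_le _)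
  have key := amgm_aux (m + 1) (Nat.succ_pos _)
    (fun j => Nat.casesOn j (2 + 1 / (m : ℝ) - ∑ j ∈ Finset.range m, r (j + 1))
      (fun i => 1 + r (i + 1))) (by
      intro j hj
      cases j with
      | zero => show 0 ≤ 2 + 1 / (m : ℝ) - _; linarith
      | succ i =>
        have := hz i (by simpa using hj)
        show 0 ≤ 1 + r (i + 1)
        linarith)
  rw [Finset.sum_range_succ', Finset.prod_range_succ'] at key
  simp only [Finset.sum_add_distrib, Finset.sum_const, Finset.card_range, nsmul_eq_mul,
    mul_one] at key
  generalize ∑ j ∈ Finset.range m, r (j + 1) = S at *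
  generalize ∏ j ∈ Finset.range m, (1 + r (j + 1)) = P at *
  have e : ((m : ℝ) + S + (2 + 1 / (m : ℝ) - S)) / ((m + 1 : ℕ) : ℝ) = 1 + 1 / (m : ℝ) := by
    push_cast
    field_simp
    ring
  change P * (2 + 1 / (m : ℝ) - S) ≤
    (((m : ℝ) + S + (2 + 1 / (m : ℝ) - S)) / ((m + 1 : ℕ) : ℝ)) ^ (m + 1) at key
  rw [e, pow_succ] at key
  generalize 1 / (m : ℝ) = t at *
  have hA : 0 < (1 + t) ^ m := by positivity
  generalize (1 + t) ^ m = A at *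
  rw [inv_eq_one_div, div_lt_div_iff₀ hA (by positivity)]
  have h1 : (1 + t) * (1 + r 0) < (S + r 0) * (2 + t - S) := by nlinarith
  have h2 : P * ((1 + t) * (1 + r 0)) < P * ((S + r 0) * (2 + t - S)) :=
    mul_lt_mul_of_pos_left h1 hP
  have hpos : 0 < S + r 0 := by linarith
  have h3 := mul_le_mul_of_nonneg_left key hpos.le
  have h4 : (1 + t) * (P * (1 + r 0)) < (1 + t) * ((S + r 0) * A) := by nlinarith
  have := lt_of_mul_lt_mul_left h4 (by linarith)
  linarith
end

section
/- Let m be a positive integer and, for α ∈ (0,1), set r_0(α) := 2 − 2α + 1/m and r_1(α) = ⋯ = r_m(α) := α/m. Then, writing R(α) := r_0(α) + ⋯ + r_m(α), the quantity V(α) := R(α) / ∏_{j=0}^m (1 + r_j(α)) tends to (1 + 1/m)^{−m} as α → 1 from below. Consequently, the strict lower bound V > (1 + 1/m)^{−m} in item 3 of Theorem 3 is sharp: V can be made arbitrarily close to (1 + 1/m)^{−m}. -/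
/-- Sharpness of item 3 of Theorem 3 of the paper: with the odds
`r₀(α) = 2 - 2α + 1/m` and `r₁(α) = ⋯ = r_m(α) = α/m`, the success probability
`V(α) = R(α) / ∏ (1 + r_j(α))` tends to `(1 + 1/m)⁻ᵐ` as `α → 1⁻`; in particular
`V` can be made arbitrarily close to `(1 + 1/m)⁻ᵐ` with `α ∈ (0,1)`. -/
theorem odds_lower_bound_case3_sharp (m : ℕ) (hm : 0 < m) :
    Filter.Tendsto
      (fun α : ℝ =>
        ((2 - 2 * α + 1 / (m : ℝ)) + m * (α / m)) /
          ((1 + (2 - 2 * α + 1 / (m : ℝ))) * (1 + α / m) ^ m))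
      (nhdsWithin 1 (Set.Iio 1)) (nhds (((1 + 1 / (m : ℝ)) ^ m)⁻¹)) ∧
    ∀ ε > (0 : ℝ), ∃ α ∈ Set.Ioo (0 : ℝ) 1,
      ((2 - 2 * α + 1 / (m : ℝ)) + m * (α / m)) /
          ((1 + (2 - 2 * α + 1 / (m : ℝ))) * (1 + α / m) ^ m) <
        ((1 + 1 / (m : ℝ)) ^ m)⁻¹ + ε := by
  have hm' : (0 : ℝ) < m := by exact_mod_cast hm
  have key : Filter.Tendsto
      (fun α : ℝ =>
        ((2 - 2 * α + 1 / (m : ℝ)) + m * (α / m)) /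
          ((1 + (2 - 2 * α + 1 / (m : ℝ))) * (1 + α / m) ^ m))
      (nhdsWithin 1 (Set.Iio 1)) (nhds (((1 + 1 / (m : ℝ)) ^ m)⁻¹)) := by
    have hpos : (0 : ℝ) < 1 + 1 / (m : ℝ) := by positivity
    have hc : ContinuousAt (fun α : ℝ =>
        ((2 - 2 * α + 1 / (m : ℝ)) + m * (α / m)) /
          ((1 + (2 - 2 * α + 1 / (m : ℝ))) * (1 + α / m) ^ m)) 1 := by
      apply ContinuousAt.div
      · fun_prop
      · fun_prop
      · have h : (1 + (2 - 2 * (1 : ℝ) + 1 / (m : ℝ))) = 1 + 1 / (m : ℝ) := by ring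
        rw [h]
        positivity
    have hv : ((2 - 2 * (1 : ℝ) + 1 / (m : ℝ)) + m * (1 / m)) /
          ((1 + (2 - 2 * (1 : ℝ) + 1 / (m : ℝ))) * (1 + 1 / m) ^ m)
          = ((1 + 1 / (m : ℝ)) ^ m)⁻¹ := by
      have h1 : (2 - 2 * (1 : ℝ) + 1 / (m : ℝ)) + m * (1 / m) = 1 + 1 / (m : ℝ) := by
        rw [mul_one_div_cancel hm'.ne']; ring
      have h2 : (1 + (2 - 2 * (1 : ℝ) + 1 / (m : ℝ))) = 1 + 1 / (m : ℝ) := by ring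
      rw [h1, h2, div_mul_eq_div_div, div_self hpos.ne', one_div]
    have ht := hc.tendsto
    simp only [hv] at ht
    exact ht.mono_left nhdsWithin_le_nhds
  refine ⟨key, fun ε hε => ?_⟩
  have h1 := key.eventually_lt_const (lt_add_of_pos_right _ hε)
  have h2 : ∀ᶠ α : ℝ in nhdsWithin 1 (Set.Iio 1), α ∈ Set.Ioo (0 : ℝ) 1 :=
    Ioo_mem_nhdsLT (by norm_num)
  obtain ⟨α, ha, hb⟩ := (h2.and h1).exists
  exact ⟨α, ha, hb⟩
end

section
/- Let k and n be positive integers with k ≤ n, and let r_1, …, r_k be nonnegative real numbers with r_1 + ⋯ + r_k = 1. Then, with V := 1 / ∏_{j=1}^k (1 + r_j), the following chain of inequalities holds: 1/e < (1 + 1/n)^{−n} ≤ (1 + 1/k)^{−k} ≤ V ≤ 1/2. -/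
theorem odds_one_add_sum_le {ι : Type*} (s : Finset ι) (r : ι → ℝ) (hr : ∀ j, 0 ≤ r j) :
    1 + ∑ j ∈ s, r j ≤ ∏ j ∈ s, (1 + r j) := by
  classical
  induction s using Finset.induction_on with
  | empty => simp
  | insert a s ha ih =>
    rw [Finset.sum_insert ha, Finset.prod_insert ha]
    have h1 : 0 ≤ ∑ j ∈ s, r j := Finset.sum_nonneg (fun j _ => hr j)
    have h2 := mul_le_mul_of_nonneg_left ih (by linarith [hr a] : 0 ≤ 1 + r a)
    nlinarith [mul_nonneg (hr a) h1]

/-- Remark 1 of the paper: if the nonnegative odds `r₁, …, r_k` (with `k ≤ n`)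
sum to `1`, then with `V = 1 / ∏ (1 + r_j)` one has
`1/e < (1 + 1/n)⁻ⁿ ≤ (1 + 1/k)⁻ᵏ ≤ V ≤ 1/2`. -/
theorem odds_remark1 (k n : ℕ) (hk : 0 < k) (hkn : k ≤ n) (r : Fin k → ℝ)
    (hr : ∀ j, 0 ≤ r j) (hsum : ∑ j, r j = 1) :
    1 / Real.exp 1 < ((1 + 1 / (n : ℝ)) ^ n)⁻¹ ∧
    ((1 + 1 / (n : ℝ)) ^ n)⁻¹ ≤ ((1 + 1 / (k : ℝ)) ^ k)⁻¹ ∧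
    ((1 + 1 / (k : ℝ)) ^ k)⁻¹ ≤ 1 / ∏ j, (1 + r j) ∧
    1 / ∏ j, (1 + r j) ≤ 1 / 2 := by
  have hn : 0 < n := by omega
  have hkR : (0 : ℝ) < k := by exact_mod_cast hk
  have hnR : (0 : ℝ) < n := by exact_mod_cast hn
  have hknR : (k : ℝ) ≤ n := by exact_mod_cast hkn
  have hprod : 0 < ∏ j, (1 + r j) := Finset.prod_pos (fun j _ => by linarith [hr j])
  refine ⟨?_, ?_, ?_, ?_⟩
  · rw [one_div]
    apply inv_strictAnti₀ (by positivity)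
    have h : 1 + 1 / (n : ℝ) < Real.exp (1 / n) := by
      rw [add_comm]
      exact Real.add_one_lt_exp (by positivity)
    calc (1 + 1 / (n : ℝ)) ^ n < Real.exp (1 / n) ^ n :=
          pow_lt_pow_left₀ h (by positivity) hn.ne'
      _ = Real.exp 1 := by
          rw [← Real.exp_nat_mul]
          congr 1
          field_simp
  · apply inv_anti₀ (by positivity)
    have h := one_add_mul_self_le_rpow_one_add (s := 1 / (n : ℝ)) (p := n / k)
      (by have : 0 < 1 / (n : ℝ) := by positivity
          linarith) (by rw [le_div_iff₀ hkR]; linarith)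
    have e : (n : ℝ) / k * (1 / n) = 1 / k := by field_simp
    rw [e] at h
    calc (1 + 1 / (k : ℝ)) ^ k ≤ ((1 + 1 / (n : ℝ)) ^ ((n : ℝ) / k)) ^ k :=
          pow_le_pow_left₀ (by positivity) h k
      _ = (1 + 1 / (n : ℝ)) ^ n := by
          rw [← Real.rpow_mul_natCast (by positivity), div_mul_cancel₀ _ hkR.ne',
            Real.rpow_natCast]
  · rw [one_div (∏ j, (1 + r j))]
    apply inv_anti₀ hprod
    set c : ℝ := 1 + 1 / (k : ℝ) with hc
    have hcpos : 0 < c := by positivity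
    have h : ∀ j, 1 + r j ≤ c * Real.exp ((1 + r j) / c - 1) := fun j => by
      have := Real.add_one_le_exp ((1 + r j) / c - 1)
      rw [sub_add_cancel, div_le_iff₀ hcpos] at this
      linarith
    calc ∏ j, (1 + r j) ≤ ∏ j, (c * Real.exp ((1 + r j) / c - 1)) :=
          Finset.prod_le_prod (fun j _ => by linarith [hr j]) (fun j _ => h j)
      _ = c ^ k := by
          rw [Finset.prod_mul_distrib, ← Real.exp_sum, Finset.sum_sub_distrib,
            ← Finset.sum_div, Finset.sum_add_distrib, hsum]
          have : ((k : ℝ) + 1) / c - k = 0 := by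
            rw [hc]
            field_simp
            ring
          simp [this]
  · apply one_div_le_one_div_of_le two_pos
    have := odds_one_add_sum_le Finset.univ r hr
    rw [hsum] at this
    linarith
end

section
/- Let m be a positive integer and define f(x, y) := ln x − ln(1 + x − y) − m · ln(1 + y/m) on the domain D := { (x, y) ∈ ℝ² : x > 1 + 1/m, 0 ≤ y < 1 }. Then on D the function f is strictly increasing in x (its partial derivative 1/x − 1/(1 + x − y) is positive) and strictly decreasing in y (its partial derivative 1/(1 + x − y) − m/(m + y) is negative). Consequently, the infimum of f over D is the limit of f(x, y) as x → 1 + 1/m and y → 1, namely −m · ln(1 + 1/m); equivalently, x / ((1 + x − y)(1 + y/m)^m) > (1 + 1/m)^{−m} for all (x, y) ∈ D. -/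
theorem aux_anti (m : ℕ) (hm : 0 < m) (x : ℝ) (hx : 1 + 1 / (m : ℝ) < x) :
    ContinuousOn
        (fun y : ℝ => Real.log x - Real.log (1 + x - y) - m * Real.log (1 + y / m))
        (Set.Icc 0 1) ∧
    StrictAntiOn
        (fun y : ℝ => Real.log x - Real.log (1 + x - y) - m * Real.log (1 + y / m))
        (Set.Icc 0 1) := by
  have hm' : (0 : ℝ) < m := by exact_mod_cast hm
  have h1 : (0 : ℝ) < 1 / m := by positivity
  have hmx : (m : ℝ) + 1 < m * x := by
    have := mul_lt_mul_of_pos_left hx hm'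
    have h2 : (m : ℝ) * (1 + 1 / m) = m + 1 := by field_simp
    linarith
  have hd : ∀ y ∈ Set.Icc (0 : ℝ) 1, HasDerivAt
      (fun y : ℝ => Real.log x - Real.log (1 + x - y) - m * Real.log (1 + y / m))
      (1 / (1 + x - y) - m / (m + y)) y := by
    intro y hy
    have hp : 0 < 1 + x - y := by linarith [hy.2]
    have hq : 0 < 1 + y / m := by have := div_nonneg hy.1 hm'.le; linarith
    have hr : 0 < m + y := by linarith [hy.1]
    have e1 : HasDerivAt (fun y : ℝ => 1 + x - y) (-1) y := by
      simpa using (hasDerivAt_id y).const_sub (1 + x)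
    have e2 : HasDerivAt (fun y : ℝ => 1 + y / m) (1 / m) y :=
      ((hasDerivAt_id y).div_const (m : ℝ)).const_add 1
    have e3 := ((e1.log hp.ne').const_sub (Real.log x)).sub
      ((e2.log hq.ne').const_mul (m : ℝ))
    refine HasDerivAt.congr_deriv (f := fun y : ℝ => Real.log x - Real.log (1 + x - y) - m * Real.log (1 + y / m)) e3 ?_
    have : 1 + y / m = (m + y) / m := by field_simp
    rw [this]
    field_simp
  have hc := fun y hy => (hd y hy).continuousAt.continuousWithinAt (s := Set.Icc 0 1)
  refine ⟨hc, strictAntiOn_of_deriv_neg (convex_Icc 0 1) hc ?_⟩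
  intro y hy
  have hy' := interior_subset hy
  rw [(hd y hy').deriv, sub_neg, div_lt_div_iff₀ (by linarith [hy'.2]) (by linarith [hy'.1])]
  nlinarith [hy'.2]

theorem aux_lt (m : ℕ) (hm : 0 < m) (x y : ℝ) (hx : 1 + 1 / (m : ℝ) < x) (h0 : 0 ≤ y)
    (hy : y < 1) : -(m : ℝ) * Real.log (1 + 1 / m) <
      Real.log x - Real.log (1 + x - y) - m * Real.log (1 + y / m) := by
  have := (aux_anti m hm x hx).2 ⟨h0, hy.le⟩ ⟨zero_le_one, le_rfl⟩ hy
  have e : 1 + x - 1 = x := by ring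
  simp only [e] at this
  linarith

/-- Two-variable monotonicity argument in the proof of item 3 of Theorem 3 of the
paper: on `D = {(x,y) : x > 1 + 1/m, 0 ≤ y < 1}`, the function
`f(x,y) = ln x - ln(1 + x - y) - m·ln(1 + y/m)` is strictly increasing in `x` and
strictly decreasing in `y`; consequently its infimum over `D` equals
`-m·ln(1 + 1/m)`, and `x / ((1 + x - y)(1 + y/m)^m) > (1 + 1/m)⁻ᵐ` on `D`. -/
theorem f_monotone_and_inf (m : ℕ) (hm : 0 < m) :
    (∀ y : ℝ, 0 ≤ y → y < 1 →
      StrictMonoOn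
        (fun x : ℝ => Real.log x - Real.log (1 + x - y) - m * Real.log (1 + y / m))
        (Set.Ioi (1 + 1 / (m : ℝ)))) ∧
    (∀ x : ℝ, 1 + 1 / (m : ℝ) < x →
      StrictAntiOn
        (fun y : ℝ => Real.log x - Real.log (1 + x - y) - m * Real.log (1 + y / m))
        (Set.Ico 0 1)) ∧
    IsGLB {z : ℝ | ∃ x y : ℝ, 1 + 1 / (m : ℝ) < x ∧ 0 ≤ y ∧ y < 1 ∧
        z = Real.log x - Real.log (1 + x - y) - m * Real.log (1 + y / m)}
      (-(m : ℝ) * Real.log (1 + 1 / m)) ∧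
    (∀ x y : ℝ, 1 + 1 / (m : ℝ) < x → 0 ≤ y → y < 1 →
      ((1 + 1 / (m : ℝ)) ^ m)⁻¹ < x / ((1 + x - y) * (1 + y / m) ^ m)) := by
  have hm' : (0 : ℝ) < m := by exact_mod_cast hm
  have h1 : (0 : ℝ) < 1 / m := by positivity
  refine ⟨?_, ?_, ⟨?_, ?_⟩, ?_⟩
  · intro y h0 hy a ha b hb hab
    simp only [Set.mem_Ioi] at ha hb
    have ha0 : 0 < a := by linarith
    have hb0 : 0 < b := by linarith
    have hpa : 0 < 1 + a - y := by linarith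
    have hpb : 0 < 1 + b - y := by linarith
    have : Real.log (a * (1 + b - y)) < Real.log (b * (1 + a - y)) :=
      Real.log_lt_log (by positivity) (by nlinarith)
    rw [Real.log_mul ha0.ne' hpb.ne', Real.log_mul hb0.ne' hpa.ne'] at this
    simp only
    linarith
  · intro x hx
    exact (aux_anti m hm x hx).2.mono Set.Ico_subset_Icc_self
  · rintro z ⟨x, y, hx, h0, hy, rfl⟩
    exact (aux_lt m hm x y hx h0 hy).le
  · intro b hb
    have hx : 1 + 1 / (m : ℝ) < 2 + 1 / (m : ℝ) := by linarith
    set x := 2 + 1 / (m : ℝ) with hxd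
    have hc := (aux_anti m hm x hx).1 1 ⟨zero_le_one, le_rfl⟩
    have ht := (hc.mono Set.Ico_subset_Icc_self).tendsto
    have hne : (nhdsWithin (1 : ℝ) (Set.Ico 0 1)).NeBot := by
      rw [← mem_closure_iff_nhdsWithin_neBot, closure_Ico zero_ne_one]
      exact ⟨zero_le_one, le_rfl⟩
    have hle := ge_of_tendsto ht (b := b) (by
      filter_upwards [self_mem_nhdsWithin] with y hy
      exact hb ⟨x, y, hx, hy.1, hy.2, rfl⟩)
    have e : 1 + x - 1 = x := by ring
    simp only [e] at hle
    linarith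
  · intro x y hx h0 hy
    have h := aux_lt m hm x y hx h0 hy
    have hx0 : 0 < x := by linarith
    have hp : 0 < 1 + x - y := by linarith
    have hq : 0 < 1 + y / m := by have := div_nonneg h0 hm'.le; linarith
    have hr : 0 < 1 + 1 / (m : ℝ) := by linarith
    rw [← Real.log_lt_log_iff (by positivity) (by positivity), Real.log_inv, Real.log_pow,
      Real.log_div hx0.ne' (by positivity), Real.log_mul hp.ne' (by positivity), Real.log_pow]
    linarith
end
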